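/- arXiv:math-ph/0401053 — 2 statements merged into one kernel-verified Lean document; each statement's English description precedes it below -/
import Mathlib

section
/- Let d ≥ 1 and let (φ_j)_{j∈ℕ} be a sequence in the Schwartz space 𝒮(ℝ^d; ℂ). Then there exists a family (f^ε)_{0<ε≤1} in 𝒮(ℝ^d; ℂ) such that for every K ∈ ℕ and every s ∈ ℕ there are constants C > 0 and ε₀ ∈ (0,1] with ‖ f^ε − Σ_{j=0}^{K-1} ε^j φ_j ‖_{X^s_ε} ≤ C ε^K for all 0 < ε ≤ ε₀. -/
open MeasureTheory
open scoped ENNReal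

/-- Partial derivative of `f` in the coordinate direction `i`. -/
noncomputable def pderiv' (d : ℕ) (i : Fin d) (f : (Fin d → ℝ) → ℂ) :
    (Fin d → ℝ) → ℂ :=
  fun x => fderiv ℝ f x (Pi.single i 1)

/-- Iterated partial derivatives along a list of coordinate directions. -/
noncomputable def pderivList (d : ℕ) : List (Fin d) → ((Fin d → ℝ) → ℂ) → ((Fin d → ℝ) → ℂ)
  | [], f => f
  | i :: l, f => pderiv' d i (pderivList d l f)

/-- The list of directions prescribed by a multi-index `β` (each `i` repeated `β i` times). -/
def multiIndexList (d : ℕ) (β : Fin d → ℕ) : List (Fin d) :=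
  (List.ofFn fun i : Fin d => List.replicate (β i) i).flatten

/-- `(ε ∂_x)^β f = ε^{|β|} ∂_x^β f`. -/
noncomputable def epsDeriv (d : ℕ) (ε : ℝ) (β : Fin d → ℕ) (f : (Fin d → ℝ) → ℂ) :
    (Fin d → ℝ) → ℂ :=
  fun x => (ε ^ (∑ i, β i) : ℝ) * pderivList d (multiIndexList d β) f x

/-- `x^α (ε ∂_x)^β f`. -/
noncomputable def monoEpsDeriv (d : ℕ) (ε : ℝ) (α β : Fin d → ℕ) (f : (Fin d → ℝ) → ℂ) :
    (Fin d → ℝ) → ℂ :=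
  fun x => (∏ i, ((x i : ℂ) ^ (α i))) * epsDeriv d ε β f x

/-- The `L²(ℝ^d)` norm. -/
noncomputable def L2Norm (d : ℕ) (g : (Fin d → ℝ) → ℂ) : ℝ :=
  (eLpNorm g 2 volume).toReal

/-- The norm `‖f‖_{X^s_ε} = Σ_{|α|+|β| ≤ s} ‖x^α (ε∂)^β f‖_{L²}`; the sum ranges over all
pairs of multi-indices with total degree at most `s` (entries of such a multi-index cannot
exceed `s`, so they are faithfully enumerated by `Fin d → Fin (s+1)`). -/
noncomputable def XNorm (d s : ℕ) (ε : ℝ) (f : (Fin d → ℝ) → ℂ) : ℝ :=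
  ∑ p : (Fin d → Fin (s + 1)) × (Fin d → Fin (s + 1)),
    if (∑ i, (p.1 i : ℕ)) + (∑ i, (p.2 i : ℕ)) ≤ s then
      L2Norm d (monoEpsDeriv d ε (fun i => (p.1 i : ℕ)) (fun i => (p.2 i : ℕ)) f)
    else 0

/-!
Lemma 3.7 (Borel-type lemma): given a sequence `(φ_j)` of Schwartz functions, there is a
family `(f^ε)_{0<ε≤1}` of Schwartz functions admitting `Σ_j ε^j φ_j` as an asymptotic
expansion to every order `K` in every norm `X^s_ε`.
-/

theorem borel_abstract {E : Type*} [AddCommGroup E] [Module ℂ E]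
    (q : ℕ → Seminorm ℂ E) (φ : ℕ → E) :
    ∃ f : ℝ → E, ∀ K s : ℕ, ∃ C > (0 : ℝ), ∃ ε₀ ∈ Set.Ioc (0 : ℝ) 1,
        ∀ ε : ℝ, 0 < ε → ε ≤ ε₀ →
          q s (f ε - ∑ j ∈ Finset.range K, (ε : ℂ) ^ j • φ j) ≤ C * ε ^ K := by
  classical
  let M : ℕ → ℝ := fun j => 1 + ∑ s ∈ Finset.range (j + 1), q s (φ j)
  have hM1 : ∀ j, 1 ≤ M j := fun j => by
    have : 0 ≤ ∑ s ∈ Finset.range (j + 1), q s (φ j) :=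
      Finset.sum_nonneg fun s _ => apply_nonneg _ _
    simp only [M]; linarith
  have hMq : ∀ j s, s ≤ j → q s (φ j) ≤ M j := fun j s hs => by
    have : q s (φ j) ≤ ∑ s ∈ Finset.range (j + 1), q s (φ j) :=
      Finset.single_le_sum (f := fun s => q s (φ j)) (fun s _ => apply_nonneg _ _)
        (Finset.mem_range.2 (by omega))
    simp only [M]; linarith
  let A : ℝ → Finset ℕ := fun ε =>
    (Finset.range (⌈1 / ε⌉₊ + 1)).filter (fun j => ε * (2 ^ j * M j) ≤ 1)
  have hA : ∀ ε : ℝ, 0 < ε → ∀ j, ε * (2 ^ j * M j) ≤ 1 → j ∈ A ε := by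
    intro ε hε j hj
    refine Finset.mem_filter.2 ⟨Finset.mem_range.2 ?_, hj⟩
    have h1 : (j : ℝ) < 2 ^ j := by exact_mod_cast Nat.lt_two_pow_self
    have h2 : (2 : ℝ) ^ j ≤ 2 ^ j * M j := le_mul_of_one_le_right (by positivity) (hM1 j)
    have h3 : (j : ℝ) ≤ 1 / ε := by
      rw [le_div_iff₀ hε]
      nlinarith
    have h4 := h3.trans (Nat.le_ceil _)
    have : j ≤ ⌈1 / ε⌉₊ := by exact_mod_cast h4
    omega
  refine ⟨fun ε => ∑ j ∈ A ε, (ε : ℂ) ^ j • φ j, fun K s => ?_⟩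
  let c : ℕ → ℝ := fun j => (if j ∈ Finset.range (K + s + 1) then q s (φ j) else 0) + (1 / 2) ^ j
  have hc0 : ∀ j, 0 ≤ c j := fun j => by
    have : 0 ≤ q s (φ j) := apply_nonneg _ _
    simp only [c]; split_ifs <;> positivity
  have hcs : Summable c := by
    refine Summable.add ?_ summable_geometric_two
    refine summable_of_ne_finset_zero (s := Finset.range (K + s + 1)) fun j hj => ?_
    simp [hj]
  have hT : 0 ≤ ∑' j, c j := tsum_nonneg hc0
  let S : ℝ := ∑ j ∈ Finset.range (K + s + 1), 2 ^ j * M j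
  have hnn : ∀ j, 0 ≤ 2 ^ j * M j := fun j => by have := hM1 j; positivity
  have hS : ∀ j, j < K + s + 1 → 2 ^ j * M j ≤ S := fun j hj =>
    Finset.single_le_sum (f := fun j => 2 ^ j * M j) (fun j _ => hnn j) (Finset.mem_range.2 hj)
  have hS1 : 1 ≤ S := by
    have := hS 0 (by omega)
    have := hM1 0
    simp at *; linarith
  refine ⟨(∑' j, c j) + 1, by linarith, 1 / S, ⟨by positivity, ?_⟩, ?_⟩
  · rw [div_le_one (by linarith)]; exact hS1
  intro ε hε hε0
  have hεS : ε * S ≤ 1 := by rwa [le_div_iff₀ (by linarith)] at hε0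
  have hε1 : ε ≤ 1 := by nlinarith
  have hsub : Finset.range K ⊆ A ε := fun j hj => hA ε hε j <| by
    have := hS j (by have := Finset.mem_range.1 hj; omega)
    nlinarith
  simp only
  rw [← Finset.sum_sdiff hsub, add_sub_cancel_right]
  have hterm : ∀ j ∈ A ε \ Finset.range K, q s ((ε : ℂ) ^ j • φ j) ≤ c j * ε ^ K := by
    intro j hj
    rw [Finset.mem_sdiff, Finset.mem_range, not_lt] at hj
    obtain ⟨hjA, hKj⟩ := hj
    have hjA := (Finset.mem_filter.1 hjA).2
    have hq : 0 ≤ q s (φ j) := apply_nonneg _ _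
    rw [map_smul_eq_mul, norm_pow, Complex.norm_real, Real.norm_of_nonneg hε.le]
    by_cases h : j < K + s + 1
    · have h1 : ε ^ j ≤ ε ^ K := pow_le_pow_of_le_one hε.le hε1 hKj
      have h2 : q s (φ j) ≤ c j := by
        simp only [c, Finset.mem_range, h, if_true]
        have : (0 : ℝ) ≤ (1 / 2) ^ j := by positivity
        linarith
      calc ε ^ j * q s (φ j) ≤ ε ^ K * c j := by gcongr
        _ = _ := mul_comm _ _
    · have h1 : ε ^ j ≤ ε ^ (K + 1) := pow_le_pow_of_le_one hε.le hε1 (by omega)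
      have h2 : c j = (1 / 2) ^ j := by simp only [c, Finset.mem_range, h, if_false, zero_add]
      have h3 : ε * M j ≤ (1 / 2) ^ j := by
        rw [one_div, inv_pow, ← one_div, le_div_iff₀ (by positivity)]
        linarith
      rw [h2]
      calc ε ^ j * q s (φ j) ≤ ε ^ (K + 1) * M j := by
            gcongr
            exact hMq j s (by omega)
        _ = (ε * M j) * ε ^ K := by ring
        _ ≤ _ := by gcongr
  calc q s (∑ j ∈ A ε \ Finset.range K, (ε : ℂ) ^ j • φ j)
      ≤ ∑ j ∈ A ε \ Finset.range K, q s ((ε : ℂ) ^ j • φ j) :=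
        Finset.le_sum_of_subadditive (q s) (map_zero (q s)).le (map_add_le_add _) _ _
    _ ≤ ∑ j ∈ A ε \ Finset.range K, c j * ε ^ K := Finset.sum_le_sum hterm
    _ = (∑ j ∈ A ε \ Finset.range K, c j) * ε ^ K := by rw [Finset.sum_mul]
    _ ≤ ((∑' j, c j) + 1) * ε ^ K := by
        have := hcs.sum_le_tsum (A ε \ Finset.range K) (fun j _ => hc0 j)
        gcongr
        linarith

theorem exists_pderivList (d : ℕ) (l : List (Fin d)) :
    ∃ D : SchwartzMap (Fin d → ℝ) ℂ →L[ℂ] SchwartzMap (Fin d → ℝ) ℂ,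
      ∀ g, ⇑(D g) = pderivList d l g := by
  induction l with
  | nil => exact ⟨ContinuousLinearMap.id ℂ _, fun g => rfl⟩
  | cons i l ih =>
    obtain ⟨D, hD⟩ := ih
    refine ⟨(SchwartzMap.evalCLM ℂ (Fin d → ℝ) ℂ (Pi.single i (1 : ℝ))) ∘L
      (SchwartzMap.fderivCLM ℂ (Fin d → ℝ) ℂ) ∘L D, fun g => ?_⟩
    funext x
    simp only [pderivList, pderiv', ← hD]
    rfl

theorem mono_growth (d : ℕ) (α : Fin d → ℕ) (t : Finset (Fin d)) :
    Function.HasTemperateGrowth (fun x : Fin d → ℝ => ∏ i ∈ t, ((x i : ℂ) ^ (α i))) := by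
  classical
  induction t using Finset.induction_on with
  | empty => simpa using Function.HasTemperateGrowth.const (1 : ℂ)
  | insert i t hi ih =>
    simp only [Finset.prod_insert hi]
    refine Function.HasTemperateGrowth.mul (Function.HasTemperateGrowth.pow ?_ _) ih
    exact (Complex.ofRealCLM ∘L
      (ContinuousLinearMap.proj i : (Fin d → ℝ) →L[ℝ] ℝ)).hasTemperateGrowth

theorem exists_L2 (d : ℕ) (α β : Fin d → ℕ) :
    ∃ L : SchwartzMap (Fin d → ℝ) ℂ →L[ℂ] Lp ℂ 2 (volume : Measure (Fin d → ℝ)),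
      ∀ (ε : ℝ) (g : SchwartzMap (Fin d → ℝ) ℂ), 0 < ε → ε ≤ 1 →
        L2Norm d (monoEpsDeriv d ε α β g) ≤ ‖L g‖ := by
  obtain ⟨D, hD⟩ := exists_pderivList d (multiIndexList d β)
  let T := SchwartzMap.smulLeftCLM ℂ (fun x : Fin d → ℝ => ∏ i, ((x i : ℂ) ^ (α i))) ∘L D
  refine ⟨SchwartzMap.toLpCLM ℂ ℂ 2 volume ∘L T, fun ε g h0 h1 => ?_⟩
  have e : monoEpsDeriv d ε α β g = ((ε ^ (∑ i, β i) : ℝ) : ℂ) • ⇑(T g) := by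
    funext x
    simp only [monoEpsDeriv, epsDeriv, ← hD, T, ContinuousLinearMap.comp_apply, Pi.smul_apply,
      SchwartzMap.smulLeftCLM_apply_apply (mono_growth d α Finset.univ), smul_eq_mul]
    ring
  have hn : ‖(SchwartzMap.toLpCLM ℂ ℂ 2 volume ∘L T) g‖
      = (eLpNorm (T g) 2 volume).toReal := SchwartzMap.norm_toLp
  rw [hn, L2Norm, e, eLpNorm_const_smul, ENNReal.toReal_mul, toReal_enorm, Complex.norm_real,
    Real.norm_of_nonneg (by positivity)]
  exact mul_le_of_le_one_left ENNReal.toReal_nonneg (pow_le_one₀ h0.le h1)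

theorem exists_seminorm (d s : ℕ) :
    ∃ q : Seminorm ℂ (SchwartzMap (Fin d → ℝ) ℂ),
      ∀ (ε : ℝ) (g : SchwartzMap (Fin d → ℝ) ℂ), 0 < ε → ε ≤ 1 → XNorm d s ε g ≤ q g := by
  choose L hL using fun p : (Fin d → Fin (s + 1)) × (Fin d → Fin (s + 1)) =>
    exists_L2 d (fun i => (p.1 i : ℕ)) (fun i => (p.2 i : ℕ))
  refine ⟨∑ p, (normSeminorm ℂ _).comp (L p).toLinearMap, fun ε g h0 h1 => ?_⟩
  have hs : (∑ p, (normSeminorm ℂ _).comp (L p).toLinearMap) g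
      = ∑ p, (normSeminorm ℂ _).comp (L p).toLinearMap g := by
    rw [← Seminorm.coeFnAddMonoidHom_apply, map_sum, Finset.sum_apply]
    rfl
  rw [hs, XNorm]
  refine Finset.sum_le_sum fun p _ => ?_
  split_ifs
  · exact hL p ε g h0 h1
  · exact apply_nonneg _ _

theorem borel_summation_schwartz
    (d : ℕ) (hd : 1 ≤ d)
    (φ : ℕ → SchwartzMap (Fin d → ℝ) ℂ) :
    ∃ f : ℝ → SchwartzMap (Fin d → ℝ) ℂ,
      ∀ K s : ℕ, ∃ C > (0 : ℝ), ∃ ε₀ ∈ Set.Ioc (0 : ℝ) 1,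
        ∀ ε : ℝ, 0 < ε → ε ≤ ε₀ →
          XNorm d s ε
            (fun x => f ε x - ∑ j ∈ Finset.range K, (ε : ℂ) ^ j * φ j x)
            ≤ C * ε ^ K := by
  choose q hq using exists_seminorm d
  obtain ⟨f, hf⟩ := borel_abstract q φ
  refine ⟨f, fun K s => ?_⟩
  obtain ⟨C, hC, ε₀, hε₀, h⟩ := hf K s
  refine ⟨C, hC, ε₀, hε₀, fun ε h0 h1 => ?_⟩
  have e : (fun x => f ε x - ∑ j ∈ Finset.range K, (ε : ℂ) ^ j * φ j x)
      = ⇑(f ε - ∑ j ∈ Finset.range K, (ε : ℂ) ^ j • φ j) := by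
    funext x
    simp
  rw [e]
  exact (hq s ε _ h0 (h1.trans hε₀.2)).trans (h ε h0 h1)
end

section
/- Let d ≥ 1. Let a ∈ 𝒮(ℝ^d; ℂ), let φ : ℝ^d → ℝ be smooth with all partial derivatives of every order ≥ 1 bounded on ℝ^d, and let χ : ℝ^d × ℝ^d → ℂ, (y,k) ↦ χ(y,k), be smooth and ℤ^d-periodic in y (χ(y+γ,k) = χ(y,k) for all γ ∈ ℤ^d). For ε ∈ (0,1] define v^ε(x) := a(x) χ(x/ε, ∇φ(x)) e^{iφ(x)/ε} and its Wigner transform W^ε[v^ε](x,ξ) := (2π)^{−d} ∫_{ℝ^d} v^ε(x − (ε/2)η) · conj(v^ε(x + (ε/2)η)) · e^{i ξ·η} dη. For γ* ∈ 2πℤ^d and k ∈ ℝ^d set ĉ_{γ*}(k) := ∫_{[−1/2,1/2]^d} χ(y,k) e^{−i y·γ*} dy. Then for every test function f ∈ 𝒮(ℝ^d × ℝ^d; ℂ): lim_{ε→0⁺} ∫_{ℝ^d} ∫_{ℝ^d} f(x,ξ) W^ε[v^ε](x,ξ) dξ dx = Σ_{γ* ∈ 2πℤ^d} ∫_{ℝ^d}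 f(x, ∇φ(x) + γ*) · |a(x)|² · |ĉ_{γ*}(∇φ(x))|² dx. -/
open MeasureTheory
open scoped Real ENNReal

/-!
Corollary 5.1 (specialized to `Γ = ℤ^d`, `Y = [−1/2,1/2]^d`, `Γ* = 2πℤ^d`): the Wigner
transform of the two-scale WKB family `v^ε(x) = a(x) χ(x/ε, ∇φ(x)) e^{iφ(x)/ε}` converges,
when tested against Schwartz observables, to the measure
`|a(x)|² dx ⊗ Σ_{γ*∈2πℤ^d} |ĉ_{γ*}(∇φ(x))|² δ(ξ − ∇φ(x) − γ*)`.
-/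

/-- The vector of first-order partial derivatives (spatial gradient). -/
noncomputable def spaceGrad {d : ℕ} (f : (Fin d → ℝ) → ℝ) (x : Fin d → ℝ) : Fin d → ℝ :=
  fun i => fderiv ℝ f x (Pi.single i 1)

/-- The two-scale WKB function `v^ε(x) = a(x) χ(x/ε, ∇φ(x)) e^{iφ(x)/ε}`. -/
noncomputable def wkbFun {d : ℕ} (a : (Fin d → ℝ) → ℂ) (φ : (Fin d → ℝ) → ℝ)
    (χ : (Fin d → ℝ) → (Fin d → ℝ) → ℂ) (ε : ℝ) (x : Fin d → ℝ) : ℂ :=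
  a x * χ (ε⁻¹ • x) (spaceGrad φ x) * Complex.exp (Complex.I * ((φ x / ε : ℝ) : ℂ))

/-- The Wigner transform `W^ε[v](x,ξ) = (2π)^{−d} ∫ v(x−εη/2) conj(v(x+εη/2)) e^{iξ·η} dη`. -/
noncomputable def wignerTransform {d : ℕ} (ε : ℝ) (v : (Fin d → ℝ) → ℂ)
    (x ξ : Fin d → ℝ) : ℂ :=
  ((2 * π) ^ d : ℝ)⁻¹ *
    ∫ η : Fin d → ℝ,
      v (x - (ε / 2) • η) * starRingEnd ℂ (v (x + (ε / 2) • η)) *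
        Complex.exp (Complex.I * ((∑ i, ξ i * η i : ℝ) : ℂ))

/-- The Fourier coefficient `ĉ_{γ*}(k) = ∫_{[−1/2,1/2]^d} χ(y,k) e^{−iy·γ*} dy`
of the periodic profile, for `γ* = 2πm`, `m ∈ ℤ^d`. -/
noncomputable def blochFourierCoeff {d : ℕ} (χ : (Fin d → ℝ) → (Fin d → ℝ) → ℂ)
    (m : Fin d → ℤ) (k : Fin d → ℝ) : ℂ :=
  ∫ y in Set.univ.pi (fun _ : Fin d => Set.Icc (-(1 : ℝ) / 2) (1 / 2)),
    χ y k * Complex.exp (-Complex.I * ((∑ i, y i * (2 * π * (m i : ℝ)) : ℝ) : ℂ))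

section Torus

noncomputable local instance : MeasureSpace UnitAddCircle := ⟨AddCircle.haarAddCircle⟩
local instance : Measure.IsAddHaarMeasure (volume : Measure UnitAddCircle) :=
  inferInstanceAs (Measure.IsAddHaarMeasure AddCircle.haarAddCircle)
local instance : IsProbabilityMeasure (volume : Measure UnitAddCircle) :=
  inferInstanceAs (IsProbabilityMeasure AddCircle.haarAddCircle)

/-- the unit cell -/
def cellY (d : ℕ) : Set (Fin d → ℝ) :=
  Set.univ.pi (fun _ : Fin d => Set.Icc (-(1 : ℝ) / 2) (1 / 2))

lemma cellY_ae (d : ℕ) :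
    ({x : Fin d → ℝ | ∀ i, x i ∈ Set.Ioc ((-(1:ℝ)/2)) (-(1:ℝ)/2 + 1)} : Set (Fin d → ℝ))
      =ᵐ[volume] cellY d := by
  have h := Measure.pi_Ioc_ae_eq_pi_Icc (μ := fun _ : Fin d => (volume : Measure ℝ))
    (s := Set.univ) (f := fun _ => (-(1:ℝ)/2)) (g := fun _ => 1/2)
  have e : ({x : Fin d → ℝ | ∀ i, x i ∈ Set.Ioc ((-(1:ℝ)/2)) (-(1:ℝ)/2 + 1)} : Set (Fin d → ℝ))
     = Set.univ.pi (fun _ : Fin d => Set.Ioc (-(1 : ℝ) / 2) (1 / 2)) := by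
    have : (-(1:ℝ)/2 + 1) = 1/2 := by norm_num
    rw [this]; ext x; simp [Set.mem_pi]
  rw [e]; exact h

lemma torus_integral {d : ℕ} (G : UnitAddTorus (Fin d) → ℂ) :
    ∫ t, G t = ∫ y in cellY d, G (fun i => (y i : UnitAddCircle)) := by
  rw [UnitAddTorus.integral_preimage G (fun _ => -(1:ℝ)/2)]
  exact setIntegral_congr_set (cellY_ae d)

lemma torus_lift {d : ℕ} (g : (Fin d → ℝ) → ℂ) (hg : Continuous g)
    (hp : ∀ (y : Fin d → ℝ) (γ : Fin d → ℤ), g (y + fun i => (γ i : ℝ)) = g y) :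
    ∃ G : C(UnitAddTorus (Fin d), ℂ), ∀ y : Fin d → ℝ, G (fun i => (y i : UnitAddCircle)) = g y := by
  have hq : IsOpenQuotientMap (Pi.map (fun (_ : Fin d) (r : ℝ) => (r : UnitAddCircle))) :=
    IsOpenQuotientMap.piMap (fun _ => QuotientAddGroup.isOpenQuotientMap_mk)
  have key : ∀ y y' : Fin d → ℝ, (∀ i, (y i : UnitAddCircle) = (y' i : UnitAddCircle)) → g y = g y' := by
    intro y y' h
    have : ∀ i, ∃ n : ℤ, y i = y' i + n := by
      intro i
      have := (QuotientAddGroup.eq (s := AddSubgroup.zmultiples (1:ℝ))).1 (h i)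
      obtain ⟨n, hn⟩ := AddSubgroup.mem_zmultiples_iff.1 this
      refine ⟨-n, ?_⟩
      simp at hn
      push_cast; linarith
    choose n hn using this
    rw [← hp y' n]; congr 1; ext i; exact hn i
  let G0 : UnitAddTorus (Fin d) → ℂ := fun t => g (Function.surjInv hq.surjective t)
  have hG : ∀ y : Fin d → ℝ, G0 (fun i => (y i : UnitAddCircle)) = g y := by
    intro y
    apply key
    intro i
    exact congrFun (Function.surjInv_eq hq.surjective (fun i => (y i : UnitAddCircle))) i
  refine ⟨⟨G0, ?_⟩, hG⟩
  refine hq.isQuotientMap.continuous_iff.2 ?_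
  convert! hg using 1
  ext y; exact hG y

lemma cell_shift {d : ℕ} (g : (Fin d → ℝ) → ℂ) (hg : Continuous g)
    (hp : ∀ (y : Fin d → ℝ) (γ : Fin d → ℤ), g (y + fun i => (γ i : ℝ)) = g y) (s : Fin d → ℝ) :
    ∫ y in cellY d, g (y + s) = ∫ y in cellY d, g y := by
  obtain ⟨G, hG⟩ := torus_lift g hg hp
  have h1 := torus_integral (fun t => G t)
  have h2 := torus_integral (fun t => G (t + fun i => (s i : UnitAddCircle)))
  rw [integral_add_right_eq_self (fun t => G t)] at h2
  rw [h1] at h2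
  simp only [hG] at h2
  rw [h2]
  congr 1; ext y
  rw [← hG]; congr 1

/-- Fourier coefficients over the cell -/
noncomputable def cellCoeff {d : ℕ} (g : (Fin d → ℝ) → ℂ) (m : Fin d → ℤ) : ℂ :=
  ∫ y in cellY d, g y * Complex.exp (-Complex.I * ((∑ i, y i * (2 * π * (m i : ℝ)) : ℝ) : ℂ))

lemma mFourier_neg_coe {d : ℕ} (m : Fin d → ℤ) (y : Fin d → ℝ) :
    UnitAddTorus.mFourier (-m) (fun i => (y i : UnitAddCircle)) =
      Complex.exp (-Complex.I * ((∑ i, y i * (2 * π * (m i : ℝ)) : ℝ) : ℂ)) := by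
  simp only [UnitAddTorus.mFourier, ContinuousMap.coe_mk, fourier_coe_apply]
  rw [← Complex.exp_sum]
  congr 1
  push_cast
  rw [Finset.mul_sum]
  refine Finset.sum_congr rfl fun i _ => ?_
  simp; ring

lemma cell_coeff_eq {d : ℕ} (g : (Fin d → ℝ) → ℂ) (G : C(UnitAddTorus (Fin d), ℂ))
    (hG : ∀ y : Fin d → ℝ, G (fun i => (y i : UnitAddCircle)) = g y) (m : Fin d → ℤ) :
    UnitAddTorus.mFourierCoeff (G : UnitAddTorus (Fin d) → ℂ) m = cellCoeff g m := by
  rw [UnitAddTorus.mFourierCoeff, torus_integral, cellCoeff]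
  simp only [mFourier_neg_coe, hG, smul_eq_mul, mul_comm]

lemma cell_parseval {d : ℕ} (g h : (Fin d → ℝ) → ℂ) (hg : Continuous g) (hh : Continuous h)
    (hgp : ∀ (y : Fin d → ℝ) (γ : Fin d → ℤ), g (y + fun i => (γ i : ℝ)) = g y)
    (hhp : ∀ (y : Fin d → ℝ) (γ : Fin d → ℤ), h (y + fun i => (γ i : ℝ)) = h y) :
    HasSum (fun m => starRingEnd ℂ (cellCoeff g m) * cellCoeff h m)
      (∫ y in cellY d, starRingEnd ℂ (g y) * h y) := by
  obtain ⟨G, hG⟩ := torus_lift g hg hgp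
  obtain ⟨H, hH⟩ := torus_lift h hh hhp
  have e1 := ContinuousMap.coeFn_toLp (p := 2) (𝕜 := ℂ) (volume : Measure (UnitAddTorus (Fin d))) G
  have e2 := ContinuousMap.coeFn_toLp (p := 2) (𝕜 := ℂ) (volume : Measure (UnitAddTorus (Fin d))) H
  have := UnitAddTorus.hasSum_prod_mFourierCoeff (ContinuousMap.toLp 2 volume ℂ G)
    (ContinuousMap.toLp 2 volume ℂ H)
  have i1 : ∀ m, UnitAddTorus.mFourierCoeff (ContinuousMap.toLp (E := ℂ) 2 volume ℂ G) m = cellCoeff g m := by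
    intro m
    rw [← cell_coeff_eq g G hG]
    apply integral_congr_ae
    filter_upwards [e1] with t ht
    rw [ht]
  have i2 : ∀ m, UnitAddTorus.mFourierCoeff (ContinuousMap.toLp (E := ℂ) 2 volume ℂ H) m = cellCoeff h m := by
    intro m
    rw [← cell_coeff_eq h H hH]
    apply integral_congr_ae
    filter_upwards [e2] with t ht
    rw [ht]
  simp only [i1, i2] at this
  convert! this using 1
  trans ∫ t, starRingEnd ℂ (G t) * H t
  · rw [torus_integral]; simp only [hG, hH]
  · apply integral_congr_ae
    filter_upwards [e1, e2] with t h1 h2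
    rw [h1, h2]

end Torus

lemma cellCoeff_shift {d : ℕ} (g : (Fin d → ℝ) → ℂ) (hg : Continuous g)
    (hp : ∀ (y : Fin d → ℝ) (γ : Fin d → ℤ), g (y + fun i => (γ i : ℝ)) = g y) (s : Fin d → ℝ)
    (m : Fin d → ℤ) :
    cellCoeff (fun y => g (y + s)) m =
      Complex.exp (Complex.I * ((∑ i, s i * (2 * π * (m i : ℝ)) : ℝ) : ℂ)) * cellCoeff g m := by
  unfold cellCoeff
  rw [← cell_shift (fun y => g y * Complex.exp (-Complex.I * ((∑ i, y i * (2 * π * (m i : ℝ)) : ℝ) : ℂ))) ?_ ?_ s,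
    ← integral_const_mul]
  · congr 1; ext y
    rw [mul_left_comm, ← Complex.exp_add]
    congr 2
    simp only [Pi.add_apply, add_mul, Finset.sum_add_distrib]
    push_cast; ring
  · fun_prop
  · intro y γ
    rw [hp]; congr 1
    rw [Complex.exp_eq_exp_iff_exists_int]
    refine ⟨-∑ i, γ i * m i, ?_⟩
    simp only [Pi.add_apply, add_mul, Finset.sum_add_distrib]
    push_cast
    simp only [mul_add, neg_mul, Finset.sum_mul, Finset.mul_sum]
    congr 1
    simp only [← Finset.sum_neg_distrib]
    refine Finset.sum_congr rfl fun i _ => ?_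
    ring

lemma cell_autocorr {d : ℕ} (g : (Fin d → ℝ) → ℂ) (hg : Continuous g)
    (hp : ∀ (y : Fin d → ℝ) (γ : Fin d → ℤ), g (y + fun i => (γ i : ℝ)) = g y) (η : Fin d → ℝ) :
    HasSum (fun m : Fin d → ℤ => ((‖cellCoeff g m‖ ^ 2 : ℝ) : ℂ) *
        Complex.exp (-Complex.I * ((∑ i, η i * (2 * π * (m i : ℝ)) : ℝ) : ℂ)))
      (∫ y in cellY d, g (y - (1/2:ℝ) • η) * starRingEnd ℂ (g (y + (1/2:ℝ) • η))) := by
  have hs : ∀ s : Fin d → ℝ, ∀ (y : Fin d → ℝ) (γ : Fin d → ℤ), g (y + (fun i => (γ i : ℝ)) + s) = g (y + s) := by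
    intro s y γ
    rw [add_right_comm, hp]
  have := cell_parseval (fun y => g (y + (1/2:ℝ) • η)) (fun y => g (y + (-((1/2:ℝ) • η))))
    (by fun_prop) (by fun_prop) (fun y γ => hs _ y γ) (fun y γ => hs _ y γ)
  convert! this using 1
  · ext m
    rw [cellCoeff_shift g hg hp, cellCoeff_shift g hg hp, map_mul, ← Complex.exp_conj]
    rw [mul_mul_mul_comm, ← Complex.exp_add, mul_comm]
    congr 1
    · congr 1
      simp only [map_mul, Complex.conj_I, Complex.conj_ofReal, Pi.smul_apply, Pi.neg_apply, smul_eq_mul]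
      push_cast
      simp only [Finset.mul_sum, ← Finset.sum_add_distrib]
      refine Finset.sum_congr rfl fun i _ => ?_
      ring
    · rw [← Complex.normSq_eq_conj_mul_self, Complex.normSq_eq_norm_sq]
  · congr 1; ext y; rw [mul_comm, sub_eq_add_neg]

/-- integrable weight -/
noncomputable def wt {d : ℕ} (x : Fin d → ℝ) : ℝ := ((1 + ‖x‖) ^ (d + 1))⁻¹

lemma wt_pos {d : ℕ} (x : Fin d → ℝ) : 0 < wt x := by unfold wt; positivity

lemma wt_continuous {d : ℕ} : Continuous (wt (d := d)) := by
  unfold wt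
  refine Continuous.inv₀ (by fun_prop) fun x => ?_
  positivity

lemma wt_integrable {d : ℕ} : Integrable (wt (d := d)) := by
  have h := integrable_one_add_norm (E := Fin d → ℝ) (μ := volume) (r := ((d + 1 : ℕ) : ℝ)) (by simp)
  refine h.congr (Filter.Eventually.of_forall fun x => ?_)
  simp only [wt]
  rw [Real.rpow_neg (by positivity), Real.rpow_natCast]

lemma wt_shift {d : ℕ} (x u : Fin d → ℝ) (hu : ‖u‖ ≤ 1) : wt (x + u) ≤ 2 ^ (d + 1) * wt x := by
  unfold wt
  have h : ‖x‖ ≤ ‖x + u‖ + 1 := by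
    have := norm_sub_le (x + u) u
    simp at this; linarith
  have h2 : (1 + ‖x‖) ^ (d + 1) ≤ 2 ^ (d + 1) * (1 + ‖x + u‖) ^ (d + 1) := by
    rw [← mul_pow]; gcongr; linarith [norm_nonneg (x + u)]
  rw [inv_le_comm₀ (by positivity) (by positivity), mul_inv, inv_inv, inv_mul_le_iff₀ (by positivity)]
  exact h2

lemma slice_bound {d : ℕ} (f : SchwartzMap ((Fin d → ℝ) × (Fin d → ℝ)) ℂ) :
    ∃ C : ℝ, 0 ≤ C ∧ ∀ n ≤ d + 1, ∀ x ξ : Fin d → ℝ,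
      ‖iteratedFDeriv ℝ n (fun ξ => f (x, ξ)) ξ‖ ≤ C * wt x * wt ξ := by
  refine ⟨2 ^ (2 * (d + 1)) * (Finset.Iic (2 * (d + 1), d + 1)).sup
    (fun m => SchwartzMap.seminorm ℝ m.1 m.2) f, by positivity, fun n hn x ξ => ?_⟩
  have h := SchwartzMap.one_add_le_sup_seminorm_apply (𝕜 := ℝ) (m := (2 * (d + 1), d + 1))
    (k := 2 * (d + 1)) (n := n) le_rfl hn f (x, ξ)
  set S := 2 ^ (2 * (d + 1)) * (Finset.Iic (2 * (d + 1), d + 1)).sup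
    (fun m => SchwartzMap.seminorm ℝ m.1 m.2) f
  have h1 : ‖iteratedFDeriv ℝ n (fun ξ => f (x, ξ)) ξ‖ ≤ ‖iteratedFDeriv ℝ n f (x, ξ)‖ := by
    have e : (fun ξ => f (x, ξ)) = (fun p => f ((x, 0) + p)) ∘
        (ContinuousLinearMap.inr ℝ (Fin d → ℝ) (Fin d → ℝ)) := by
      ext ξ; simp
    have hc : ContDiff ℝ n (fun p => f ((x, 0) + p)) :=
      (f.smooth n).comp (by fun_prop)
    rw [e, ContinuousLinearMap.iteratedFDeriv_comp_right _ hc ξ le_rfl, iteratedFDeriv_comp_add_left]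
    refine (ContinuousMultilinearMap.norm_compContinuousLinearMap_le _ _).trans ?_
    simp only [ContinuousLinearMap.inr_apply, Prod.mk_add_mk, add_zero, zero_add]
    refine mul_le_of_le_one_right (norm_nonneg _) ?_
    refine Finset.prod_le_one (fun _ _ => norm_nonneg _) fun _ _ => ?_
    exact ContinuousLinearMap.norm_inr_le_one ℝ (Fin d → ℝ) (Fin d → ℝ)
  refine h1.trans ?_
  have h2 : (1 + ‖x‖) ^ (d + 1) * (1 + ‖ξ‖) ^ (d + 1) ≤ (1 + ‖(x, ξ)‖) ^ (2 * (d + 1)) := by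
    rw [two_mul, pow_add (1 + ‖(x, ξ)‖) (d + 1) (d + 1)]
    have ha := norm_fst_le (x, ξ)
    have hb := norm_snd_le (x, ξ)
    simp only at ha hb
    exact mul_le_mul (pow_le_pow_left₀ (by positivity) (by linarith) _)
      (pow_le_pow_left₀ (by positivity) (by linarith) _) (by positivity) (by positivity)
  unfold wt
  rw [mul_assoc, ← mul_inv, ← div_eq_mul_inv, le_div_iff₀ (by positivity), mul_comm]
  exact (mul_le_mul_of_nonneg_right h2 (norm_nonneg _)).trans h

/-- partial Fourier transform -/
noncomputable def pF {d : ℕ} (f : (Fin d → ℝ) × (Fin d → ℝ) → ℂ) (p : (Fin d → ℝ) × (Fin d → ℝ)) : ℂ :=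
  ∫ ξ : Fin d → ℝ, f (p.1, ξ) * Complex.exp (Complex.I * ((∑ i, ξ i * p.2 i : ℝ) : ℂ))

lemma norm_exp_I (r : ℝ) : ‖Complex.exp (Complex.I * (r : ℂ))‖ = 1 := by
  rw [mul_comm]; exact Complex.norm_exp_ofReal_mul_I r

lemma wt_le_one {d : ℕ} (x : Fin d → ℝ) : wt x ≤ 1 := by
  unfold wt
  exact inv_le_one_of_one_le₀ (one_le_pow₀ (by linarith [norm_nonneg x]))

lemma pF_continuous {d : ℕ} (f : SchwartzMap ((Fin d → ℝ) × (Fin d → ℝ)) ℂ) :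
    Continuous (pF f) := by
  obtain ⟨C, hC, hb⟩ := slice_bound f
  unfold pF
  refine continuous_of_dominated (bound := fun ξ => C * wt ξ) ?_ ?_ ?_ ?_
  · intro p
    have := f.continuous
    exact Continuous.aestronglyMeasurable (by fun_prop)
  · intro p
    refine Filter.Eventually.of_forall fun ξ => ?_
    rw [norm_mul, norm_exp_I, mul_one]
    have := hb 0 (by omega) p.1 ξ
    rw [norm_iteratedFDeriv_zero] at this
    refine this.trans ?_
    have h1 := wt_le_one p.1
    have h2 := wt_pos ξ
    have : C * wt p.1 ≤ C := mul_le_of_le_one_right hC h1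
    gcongr
  · exact wt_integrable.const_mul C
  · refine Filter.Eventually.of_forall fun ξ => ?_
    have := f.continuous
    fun_prop

/-- bilinear form -/
noncomputable def bilL (d : ℕ) : (Fin d → ℝ) →L[ℝ] (Fin d → ℝ) →L[ℝ] ℝ :=
  (-(2 * π)⁻¹ : ℝ) • ∑ i, (ContinuousLinearMap.proj (R := ℝ) (φ := fun _ : Fin d => ℝ) i).smulRight
    (ContinuousLinearMap.proj (R := ℝ) (φ := fun _ : Fin d => ℝ) i)

lemma bilL_apply (d : ℕ) (v w : Fin d → ℝ) : bilL d v w = -(2 * π)⁻¹ * ∑ i, v i * w i := by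
  simp [bilL]

lemma pF_eq {d : ℕ} (f : (Fin d → ℝ) × (Fin d → ℝ) → ℂ) (x η : Fin d → ℝ) :
    pF f (x, η) = VectorFourier.fourierIntegral Real.fourierChar volume (bilL d).toLinearMap₁₂
      (fun ξ => f (x, ξ)) η := by
  unfold pF VectorFourier.fourierIntegral
  congr 1; ext ξ
  rw [Circle.smul_def, Real.fourierChar_apply, smul_eq_mul, mul_comm]
  congr 2
  simp only [ContinuousLinearMap.toLinearMap₁₂_apply_apply_apply, bilL_apply]
  push_cast
  have : (π : ℂ) ≠ 0 := by exact_mod_cast Real.pi_ne_zero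
  field_simp

lemma pF_bound {d : ℕ} (f : SchwartzMap ((Fin d → ℝ) × (Fin d → ℝ)) ℂ) :
    ∃ C : ℝ, 0 ≤ C ∧ ∀ x η : Fin d → ℝ, ‖pF f (x, η)‖ ≤ C * wt x * wt η := by
  obtain ⟨C, hC, hb⟩ := slice_bound f
  set M := ∫ ξ : Fin d → ℝ, wt ξ with hM
  have hM0 : 0 ≤ M := integral_nonneg fun ξ => (wt_pos ξ).le
  have hcd : ∀ x : Fin d → ℝ, ContDiff ℝ ((d + 1 : ℕ) : ℕ∞) (fun ξ => f (x, ξ)) := fun x =>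
    (f.smooth _).comp (by fun_prop)
  have hi : ∀ x : Fin d → ℝ, ∀ n ≤ d + 1, Integrable (fun ξ => ‖iteratedFDeriv ℝ n (fun ξ => f (x, ξ)) ξ‖) := by
    intro x n hn
    refine ((wt_integrable (d := d)).const_mul (C * wt x)).mono' ?_ ?_
    · refine Continuous.aestronglyMeasurable ?_
      exact ((hcd x).continuous_iteratedFDeriv (by exact_mod_cast hn)).norm
    · refine Filter.Eventually.of_forall fun ξ => ?_
      rw [norm_norm]; exact hb n hn x ξ
  have hI : ∀ x : Fin d → ℝ, ∀ n ≤ d + 1, ∫ ξ, ‖iteratedFDeriv ℝ n (fun ξ => f (x, ξ)) ξ‖ ≤ C * wt x * M := by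
    intro x n hn
    rw [hM, ← integral_const_mul]
    exact integral_mono (hi x n hn) (wt_integrable.const_mul _) fun ξ => hb n hn x ξ
  have h0 : ∀ x η : Fin d → ℝ, ‖pF f (x, η)‖ ≤ C * wt x * M := by
    intro x η
    rw [pF_eq]
    refine (VectorFourier.norm_fourierIntegral_le_integral_norm _ _ _ _ _).trans ?_
    simpa using hI x 0 (by omega)
  have hj : ∀ (x η : Fin d → ℝ) (j : Fin d), |η j| ^ (d + 1) * ‖pF f (x, η)‖ ≤
      (2 * π) ^ (d + 1) * (2 ^ (d + 1) * ((d + 2) * (C * wt x * M))) := by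
    intro x η j
    have := VectorFourier.pow_mul_norm_iteratedFDeriv_fourierIntegral_le (bilL d) (K := 0)
      (N := ((d + 1 : ℕ) : ℕ∞)) (μ := volume) (hcd x) (by
        intro k n hk hn
        have hk : k = 0 := by exact_mod_cast (nonpos_iff_eq_zero.1 hk)
        subst hk
        simpa using hi x n (by exact_mod_cast hn)) (k := 0) (n := d + 1) le_rfl le_rfl
        (Pi.single j 1) η
    rw [norm_iteratedFDeriv_zero, ← pF_eq f x η, bilL_apply] at this
    have hs : ∑ i, (Pi.single j 1 : Fin d → ℝ) i * η i = η j := by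
      simp [Pi.single_apply]
    rw [hs, abs_mul, mul_pow] at this
    have hn1 : ‖(Pi.single j 1 : Fin d → ℝ)‖ = 1 := by simp [Pi.norm_single]
    rw [hn1] at this
    have hsum : ∑ p ∈ Finset.range (0 + 1) ×ˢ Finset.range (d + 1 + 1),
        ∫ v, ‖v‖ ^ p.1 * ‖iteratedFDeriv ℝ p.2 (fun ξ => f (x, ξ)) v‖ ≤ (d + 2) * (C * wt x * M) := by
      rw [Finset.sum_product]
      simp only [zero_add, Finset.range_one, Finset.sum_singleton, pow_zero, one_mul]
      refine (Finset.sum_le_card_nsmul _ _ (C * wt x * M) fun n hn => hI x n ?_).trans ?_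
      · have := Finset.mem_range.1 hn; omega
      · simp; apply le_of_eq; ring
    have ha : |-(2 * π)⁻¹| = (2 * π)⁻¹ := by
      rw [abs_neg, abs_of_pos (by positivity)]
    rw [ha] at this
    have h3 : ((2 * π)⁻¹) ^ (d + 1) * (|η j| ^ (d + 1) * ‖pF f (x, η)‖) ≤
        2 ^ (d + 1) * ((d + 2) * (C * wt x * M)) := by
      rw [← mul_assoc]
      refine this.trans ?_
      simp only [one_pow, pow_zero, mul_one, one_mul, Nat.cast_zero, mul_zero, zero_add]
      gcongr
    rw [inv_pow, inv_mul_le_iff₀ (by positivity)] at h3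
    exact h3
  set Q := (2 * π) ^ (d + 1) * (2 ^ (d + 1) * ((d + 2) * (C * M))) with hQ
  have hQ0 : 0 ≤ Q := by positivity
  have hn : ∀ (x η : Fin d → ℝ), ‖η‖ ^ (d + 1) * ‖pF f (x, η)‖ ≤ Q * wt x := by
    intro x η
    rcases Nat.eq_zero_or_pos d with h | h
    · subst h
      have : η = 0 := Subsingleton.elim _ _
      subst this
      rw [norm_zero, zero_pow (by omega), zero_mul]
      exact mul_nonneg hQ0 (wt_pos x).le
    · have : Nonempty (Fin d) := ⟨⟨0, h⟩⟩
      obtain ⟨j, -, hjj'⟩ := Finset.exists_mem_eq_sup' (Finset.univ_nonempty (α := Fin d)) (fun i => ‖η i‖)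
      have hjj : ‖η j‖ = ‖η‖ := by
        refine le_antisymm (norm_le_pi_norm η j) ?_
        refine (pi_norm_le_iff_of_nonneg (norm_nonneg _)).2 fun i => ?_
        rw [← hjj']
        exact Finset.le_sup' (fun i => ‖η i‖) (Finset.mem_univ i)
      have := hj x η j
      rw [← Real.norm_eq_abs, hjj] at this
      refine this.trans (le_of_eq ?_)
      rw [hQ]; ring
  refine ⟨2 ^ d * (C * M + Q), by positivity, fun x η => ?_⟩
  unfold wt at hn h0 ⊢
  rw [← div_eq_mul_inv _ ((1 + ‖η‖) ^ (d + 1)), le_div_iff₀ (by positivity)]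
  have h5 := add_pow_le (zero_le_one) (norm_nonneg η) (d + 1)
  simp only [one_pow, Nat.add_sub_cancel] at h5
  calc ‖pF f (x, η)‖ * (1 + ‖η‖) ^ (d + 1) ≤ ‖pF f (x, η)‖ * (2 ^ d * (1 + ‖η‖ ^ (d + 1))) := by gcongr
    _ = 2 ^ d * (‖pF f (x, η)‖ + ‖η‖ ^ (d + 1) * ‖pF f (x, η)‖) := by ring
    _ ≤ 2 ^ d * (C * ((1 + ‖x‖) ^ (d + 1))⁻¹ * M + Q * ((1 + ‖x‖) ^ (d + 1))⁻¹) := by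
      exact mul_le_mul_of_nonneg_left (add_le_add (h0 x η) (hn x η)) (by positivity)
    _ = _ := by ring

lemma pF_inversion {d : ℕ} (f : SchwartzMap ((Fin d → ℝ) × (Fin d → ℝ)) ℂ) (x ζ : Fin d → ℝ) :
    ((2 * π) ^ d : ℝ)⁻¹ * ∫ η : Fin d → ℝ, pF f (x, η) *
      Complex.exp (-Complex.I * ((∑ i, ζ i * η i : ℝ) : ℂ)) = f (x, ζ) := by
  let V := EuclideanSpace ℝ (Fin d)
  let g : V → ℂ := fun v => f (x, WithLp.ofLp v)
  have hmp := PiLp.volume_preserving_ofLp (Fin d)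
  have hme : MeasurableEmbedding (@WithLp.ofLp 2 (Fin d → ℝ)) :=
    (MeasurableEquiv.toLp 2 (Fin d → ℝ)).symm.measurableEmbedding
  obtain ⟨C, hC, hb⟩ := slice_bound f
  obtain ⟨C', hC', hb'⟩ := pF_bound f
  have hcont := f.continuous
  have hgc : Continuous g := by fun_prop
  have hgi : Integrable g := by
    refine (hmp.integrable_comp_emb hme (g := fun ξ => f (x, ξ))).2 ?_
    refine ((wt_integrable (d := d)).const_mul (C * wt x)).mono' (by
      exact Continuous.aestronglyMeasurable (by fun_prop)) ?_
    refine Filter.Eventually.of_forall fun ξ => ?_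
    have := hb 0 (by omega) x ξ
    rwa [norm_iteratedFDeriv_zero] at this
  have hFinv : ∀ w : V, FourierTransformInv.fourierInv g w = pF f (x, (2 * π) • WithLp.ofLp w) := by
    intro w
    rw [Real.fourierInv_eq']
    unfold pF
    rw [← hmp.integral_comp hme]
    congr 1; ext v
    rw [smul_eq_mul, mul_comm]
    congr 2
    rw [PiLp.inner_apply]
    simp only [Pi.smul_apply, smul_eq_mul]
    rw [mul_comm, Finset.mul_sum]
    congr 2
    refine Finset.sum_congr rfl fun i _ => ?_
    simp; ring
  have hpi : Integrable (fun η : Fin d → ℝ => pF f (x, η)) := by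
    have := pF_continuous f
    refine ((wt_integrable (d := d)).const_mul (C' * wt x)).mono' (by
      exact Continuous.aestronglyMeasurable (by fun_prop)) ?_
    exact Filter.Eventually.of_forall fun ξ => hb' x ξ
  have hFi : Integrable (FourierTransformInv.fourierInv g) := by
    have h1 : Integrable (fun η : Fin d → ℝ => pF f (x, (2 * π) • η)) :=
      hpi.comp_smul (by positivity)
    have h2 := (hmp.integrable_comp_emb hme (g := fun η => pF f (x, (2 * π) • η))).2 h1
    refine h2.congr (Filter.Eventually.of_forall fun w => (hFinv w).symm)
  have hFi' : Integrable (FourierTransform.fourier g) := by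
    have := hFi.comp_neg
    refine this.congr (Filter.Eventually.of_forall fun w => ?_)
    simp only [Real.fourierInv_eq_fourier_neg]
    exact congrArg _ (neg_neg w)
  have hinv := congrFun (hgc.fourier_fourierInv_eq hgi hFi') (WithLp.toLp 2 ζ)
  have hg : g (WithLp.toLp 2 ζ) = f (x, ζ) := rfl
  rw [← hg, ← hinv, Real.fourier_eq']
  simp only [hFinv]
  have h6 := Measure.integral_comp_smul (volume : Measure (Fin d → ℝ)) (fun η => pF f (x, η) *
      Complex.exp (-Complex.I * ((∑ i, ζ i * η i : ℝ) : ℂ))) (2 * π)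
  rw [Module.finrank_fin_fun, abs_of_pos (by positivity), Complex.real_smul] at h6
  rw [← h6, ← hmp.integral_comp hme]
  congr 1; ext v
  rw [smul_eq_mul, mul_comm]
  congr 2
  rw [PiLp.inner_apply]
  push_cast
  simp only [Pi.smul_apply, smul_eq_mul, Finset.mul_sum, Finset.sum_mul]
  refine Finset.sum_congr rfl fun i _ => ?_
  simp; ring

lemma exists_rep {d : ℕ} (y : Fin d → ℝ) :
    ∃ y' ∈ Set.Icc (0 : Fin d → ℝ) 1, ∃ γ : Fin d → ℤ, y = y' + fun i => (γ i : ℝ) := by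
  refine ⟨fun i => Int.fract (y i), ⟨fun i => Int.fract_nonneg _, fun i => (Int.fract_lt_one _).le⟩,
    fun i => ⌊y i⌋, ?_⟩
  ext i; simp

lemma chi_bdd {d : ℕ} (χ : (Fin d → ℝ) → (Fin d → ℝ) → ℂ)
    (hχ : Continuous (fun p : (Fin d → ℝ) × (Fin d → ℝ) => χ p.1 p.2))
    (hχper : ∀ (y k : Fin d → ℝ) (γ : Fin d → ℤ), χ (y + fun i => (γ i : ℝ)) k = χ y k) (R : ℝ) :
    ∃ M : ℝ, 0 ≤ M ∧ ∀ y k, ‖k‖ ≤ R → ‖χ y k‖ ≤ M := by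
  have hK : IsCompact (Set.Icc (0 : Fin d → ℝ) 1 ×ˢ Metric.closedBall (0 : Fin d → ℝ) R) :=
    isCompact_Icc.prod (isCompact_closedBall _ _)
  obtain ⟨M, hM⟩ := hK.exists_bound_of_continuousOn hχ.continuousOn
  refine ⟨max M 0, le_max_right _ _, fun y k hk => ?_⟩
  obtain ⟨y', hy', γ, rfl⟩ := exists_rep y
  rw [hχper]
  exact (hM (y', k) ⟨hy', by simpa using hk⟩).trans (le_max_left _ _)

lemma chi_unif {d : ℕ} (χ : (Fin d → ℝ) → (Fin d → ℝ) → ℂ)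
    (hχ : Continuous (fun p : (Fin d → ℝ) × (Fin d → ℝ) => χ p.1 p.2))
    (hχper : ∀ (y k : Fin d → ℝ) (γ : Fin d → ℤ), χ (y + fun i => (γ i : ℝ)) k = χ y k)
    {l : Filter ℝ} (k : ℝ → Fin d → ℝ) (k₀ : Fin d → ℝ) (hk : Filter.Tendsto k l (nhds k₀))
    (y : ℝ → Fin d → ℝ) :
    Filter.Tendsto (fun ε => ‖χ (y ε) (k ε) - χ (y ε) k₀‖) l (nhds 0) := by
  rw [Metric.tendsto_nhds]
  intro δ hδ
  have h : ∀ᶠ k' in nhds k₀, ∀ y ∈ Set.Icc (0 : Fin d → ℝ) 1, ‖χ y k' - χ y k₀‖ < δ := by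
    refine isCompact_Icc.eventually_forall_of_forall_eventually (P := fun k' y => ‖χ y k' - χ y k₀‖ < δ)
      fun y _ => ?_
    have hc : Continuous (fun z : (Fin d → ℝ) × (Fin d → ℝ) => ‖χ z.2 z.1 - χ z.2 k₀‖) := by
      have h1 := hχ.comp (continuous_snd.prodMk continuous_fst : Continuous
        (fun z : (Fin d → ℝ) × (Fin d → ℝ) => (z.2, z.1)))
      have h2 := hχ.comp (continuous_snd.prodMk continuous_const : Continuous
        (fun z : (Fin d → ℝ) × (Fin d → ℝ) => (z.2, k₀)))
      exact (h1.sub h2).norm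
    have := hc.tendsto (k₀, y)
    simp only [sub_self, norm_zero] at this
    exact this.eventually (gt_mem_nhds hδ)
  filter_upwards [hk.eventually h] with ε hε
  obtain ⟨y', hy', γ, e⟩ := exists_rep (y ε)
  rw [e, hχper, hχper]
  simpa using hε y' hy'

lemma cellY_eq (d : ℕ) : cellY d = Set.Icc (fun _ => -(1:ℝ)/2) (fun _ => 1/2) := by
  rw [cellY, Set.pi_univ_Icc]

lemma cellY_compact (d : ℕ) : IsCompact (cellY d) := by rw [cellY_eq]; exact isCompact_Icc

lemma cellY_vol (d : ℕ) : (volume : Measure (Fin d → ℝ)) (cellY d) = 1 := by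
  rw [cellY_eq, Real.volume_Icc_pi]
  norm_num

lemma cellY_norm {d : ℕ} {s : Fin d → ℝ} (hs : s ∈ cellY d) : ‖s‖ ≤ 1 := by
  refine (pi_norm_le_iff_of_nonneg zero_le_one).2 fun i => ?_
  have := hs i (Set.mem_univ i)
  rw [Real.norm_eq_abs, abs_le]
  constructor <;> linarith [this.1, this.2]

lemma spaceGrad_sum {d : ℕ} (φ : (Fin d → ℝ) → ℝ) (x η : Fin d → ℝ) :
    fderiv ℝ φ x η = ∑ i, spaceGrad φ x i * η i := by
  have h : η = ∑ i, η i • (Pi.single i 1 : Fin d → ℝ) := by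
    ext j; simp [Pi.single_apply, Finset.sum_apply]
  conv_lhs => rw [h]
  rw [map_sum]
  refine Finset.sum_congr rfl fun i _ => ?_
  rw [map_smul, smul_eq_mul, mul_comm]; rfl

lemma phase_lim {d : ℕ} (φ : (Fin d → ℝ) → ℝ) (hφ : Differentiable ℝ φ) (x u : Fin d → ℝ) :
    Filter.Tendsto (fun ε : ℝ => (φ (x + ε • u) - φ x) / ε) (nhdsWithin 0 (Set.Ioi 0))
      (nhds (fderiv ℝ φ x u)) := by
  have h := ((hφ x).hasFDerivAt.hasLineDerivAt u).tendsto_slope_zero_right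
  refine h.congr fun t => ?_
  rw [smul_eq_mul]; ring

lemma three_lim {l : Filter ℝ} (P X Y X' Y' : ℝ → ℂ) (P₀ : ℂ) (M : ℝ) (hM : 0 ≤ M)
    (hP : Filter.Tendsto P l (nhds P₀))
    (hX : Filter.Tendsto (fun ε => ‖X ε - X' ε‖) l (nhds 0))
    (hY : Filter.Tendsto (fun ε => ‖Y ε - Y' ε‖) l (nhds 0))
    (bX : ∀ ε, ‖X ε‖ ≤ M) (bY : ∀ ε, ‖Y ε‖ ≤ M) (bX' : ∀ ε, ‖X' ε‖ ≤ M) :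
    Filter.Tendsto (fun ε => P ε * (X ε * starRingEnd ℂ (Y ε)) -
      P₀ * (X' ε * starRingEnd ℂ (Y' ε))) l (nhds 0) := by
  have hP' : Filter.Tendsto (fun ε => ‖P ε - P₀‖) l (nhds 0) := by
    have := (hP.sub_const P₀).norm
    simpa using this
  refine squeeze_zero_norm (a := fun ε => ‖P ε - P₀‖ * (M * M) + ‖P₀‖ * (‖X ε - X' ε‖ * M)
    + ‖P₀‖ * (M * ‖Y ε - Y' ε‖)) (fun ε => ?_) ?_
  · have e : P ε * (X ε * starRingEnd ℂ (Y ε)) - P₀ * (X' ε * starRingEnd ℂ (Y' ε)) =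
      (P ε - P₀) * (X ε * starRingEnd ℂ (Y ε)) + P₀ * ((X ε - X' ε) * starRingEnd ℂ (Y ε)) +
        P₀ * (X' ε * starRingEnd ℂ (Y ε - Y' ε)) := by
      rw [map_sub]; ring
    rw [e]
    refine (norm_add₃_le).trans ?_
    simp only [norm_mul, RCLike.norm_conj]
    have := bX ε; have := bY ε; have := bX' ε
    gcongr
  · have h1 := hP'.mul_const (M * M)
    have h2 := (hX.mul_const M).const_mul ‖P₀‖
    have h3 := (hY.const_mul M).const_mul ‖P₀‖
    simpa using (h1.add h2).add h3

lemma core_limit {d : ℕ} (Φ : (Fin d → ℝ) × (Fin d → ℝ) → ℂ) (hΦ : Continuous Φ)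
    (C : ℝ) (hC : 0 ≤ C) (hb : ∀ x η, ‖Φ (x, η)‖ ≤ C * wt x * wt η)
    (a : (Fin d → ℝ) → ℂ) (ha : Continuous a) (Ma : ℝ) (hMa : ∀ x, ‖a x‖ ≤ Ma)
    (φ : (Fin d → ℝ) → ℝ) (hφ : Differentiable ℝ φ) (hk : Continuous (spaceGrad φ))
    (R : ℝ) (hR : ∀ x, ‖spaceGrad φ x‖ ≤ R)
    (χ : (Fin d → ℝ) → (Fin d → ℝ) → ℂ)
    (hχ : Continuous (fun p : (Fin d → ℝ) × (Fin d → ℝ) => χ p.1 p.2))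
    (hχper : ∀ (y k : Fin d → ℝ) (γ : Fin d → ℤ), χ (y + fun i => (γ i : ℝ)) k = χ y k) :
    Filter.Tendsto (fun ε : ℝ => ∫ p : (Fin d → ℝ) × (Fin d → ℝ), Φ p *
        (wkbFun a φ χ ε (p.1 - (ε / 2) • p.2) * starRingEnd ℂ (wkbFun a φ χ ε (p.1 + (ε / 2) • p.2))))
      (nhdsWithin 0 (Set.Ioi 0))
      (nhds (∫ p : (Fin d → ℝ) × (Fin d → ℝ), Φ p * ((‖a p.1‖ ^ 2 : ℝ) : ℂ) *
        Complex.exp (-Complex.I * ((∑ i, spaceGrad φ p.1 i * p.2 i : ℝ) : ℂ)) *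
        ∫ y in cellY d, χ (y - (1/2:ℝ) • p.2) (spaceGrad φ p.1) *
          starRingEnd ℂ (χ (y + (1/2:ℝ) • p.2) (spaceGrad φ p.1)))) := by
  have hMa0 : 0 ≤ Ma := (norm_nonneg _).trans (hMa 0)
  obtain ⟨M, hM, hχM⟩ := chi_bdd χ hχ hχper R
  have hχ' : ∀ {Z : Type} [TopologicalSpace Z] (u w : Z → Fin d → ℝ), Continuous u → Continuous w →
      Continuous fun z => χ (u z) (w z) := fun u w hu hw => hχ.comp (hu.prodMk hw)
  have hφc := hφ.continuous
  set k := spaceGrad φ with hkdef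
  -- the wkb function
  have hvc : ∀ ε, Continuous (wkbFun a φ χ ε) := by
    intro ε
    unfold wkbFun
    have := hχ' (fun x : Fin d → ℝ => ε⁻¹ • x) k (by fun_prop) hk
    exact (ha.mul this).mul (by fun_prop)
  have hvb : ∀ ε x, ‖wkbFun a φ χ ε x‖ ≤ Ma * M := by
    intro ε x
    unfold wkbFun
    rw [norm_mul, norm_exp_I, mul_one, norm_mul]
    exact mul_le_mul (hMa x) (hχM _ _ (hR x)) (norm_nonneg _) hMa0
  let J : ℝ → (Fin d → ℝ) × (Fin d → ℝ) → ℂ := fun ε p => Φ p *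
        (wkbFun a φ χ ε (p.1 - (ε / 2) • p.2) * starRingEnd ℂ (wkbFun a φ χ ε (p.1 + (ε / 2) • p.2)))
  let A : ℝ → (Fin d → ℝ) × ((Fin d → ℝ) × (Fin d → ℝ)) → ℂ := fun ε q => J ε (q.2 + (ε • q.1, 0))
  let P0 : (Fin d → ℝ) × (Fin d → ℝ) → ℂ := fun p => Φ p * ((‖a p.1‖ ^ 2 : ℝ) : ℂ) *
        Complex.exp (-Complex.I * ((∑ i, k p.1 i * p.2 i : ℝ) : ℂ))
  let B : ℝ → (Fin d → ℝ) × ((Fin d → ℝ) × (Fin d → ℝ)) → ℂ := fun ε q => P0 q.2 *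
      (χ (q.1 + ε⁻¹ • q.2.1 - (1/2:ℝ) • q.2.2) (k q.2.1) *
        starRingEnd ℂ (χ (q.1 + ε⁻¹ • q.2.1 + (1/2:ℝ) • q.2.2) (k q.2.1)))
  let μ : Measure (Fin d → ℝ) := volume.restrict (cellY d)
  have hμ : IsProbabilityMeasure μ := ⟨by simp [μ, cellY_vol]⟩
  let ν : Measure ((Fin d → ℝ) × ((Fin d → ℝ) × (Fin d → ℝ))) := μ.prod volume
  have hJc : ∀ ε, Continuous (J ε) := by
    intro ε
    have := hvc ε
    have h1 : Continuous (starRingEnd ℂ) := Complex.continuous_conj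
    fun_prop
  have hAc : ∀ ε, Continuous (A ε) := fun ε => (hJc ε).comp (by fun_prop)
  have hP0c : Continuous P0 := by
    have h1 : ∀ i, Continuous fun p : (Fin d → ℝ) × (Fin d → ℝ) => k p.1 i := fun i =>
      (continuous_apply i).comp (hk.comp continuous_fst)
    have : Continuous fun p : (Fin d → ℝ) × (Fin d → ℝ) => a p.1 := ha.comp continuous_fst
    fun_prop
  have hBc : ∀ ε, Continuous (B ε) := by
    intro ε
    have h0 : Continuous (starRingEnd ℂ) := Complex.continuous_conj
    have h3 : Continuous fun q : (Fin d → ℝ) × ((Fin d → ℝ) × (Fin d → ℝ)) => k q.2.1 :=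
      hk.comp (by fun_prop)
    have h1 := hχ' (fun q : (Fin d → ℝ) × ((Fin d → ℝ) × (Fin d → ℝ)) =>
      q.1 + ε⁻¹ • q.2.1 - (1/2:ℝ) • q.2.2) (fun q => k q.2.1) (by fun_prop) h3
    have h2 := hχ' (fun q : (Fin d → ℝ) × ((Fin d → ℝ) × (Fin d → ℝ)) =>
      q.1 + ε⁻¹ • q.2.1 + (1/2:ℝ) • q.2.2) (fun q => k q.2.1) (by fun_prop) h3
    exact (hP0c.comp continuous_snd).mul (h1.mul (h0.comp h2))
  let D : ℝ := C * 2 ^ (d + 1) * ((Ma * M) * (Ma * M))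
  have hD0 : 0 ≤ D := by positivity
  let G : (Fin d → ℝ) × ((Fin d → ℝ) × (Fin d → ℝ)) → ℝ := fun q => D * (wt q.2.1 * wt q.2.2)
  have hGi : Integrable G ν := by
    have h1 : Integrable (fun p : (Fin d → ℝ) × (Fin d → ℝ) => wt p.1 * wt p.2) :=
      wt_integrable.mul_prod wt_integrable
    exact (h1.comp_snd μ).const_mul D
  have hae : ∀ᵐ q ∂ν, q.1 ∈ cellY d := by
    have h1 : ∀ᵐ s ∂μ, s ∈ cellY d := ae_restrict_mem (cellY_compact d).measurableSet
    exact Measure.quasiMeasurePreserving_fst.ae h1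
  have hAb : ∀ ε ∈ Set.Ioc (0:ℝ) 1, ∀ᵐ q ∂ν, ‖A ε q‖ ≤ G q := by
    intro ε hε
    filter_upwards [hae] with q hq
    obtain ⟨s, x, η⟩ := q
    simp only [A, J, G, Prod.mk_add_mk, add_zero, norm_mul, RCLike.norm_conj] at hq ⊢
    have h1 : ‖Φ (x + ε • s, η)‖ ≤ C * (2 ^ (d + 1) * wt x) * wt η := by
      refine (hb _ _).trans ?_
      have : wt (x + ε • s) ≤ 2 ^ (d + 1) * wt x := by
        apply wt_shift
        rw [norm_smul, Real.norm_eq_abs, abs_of_pos hε.1]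
        exact mul_le_one₀ hε.2 (norm_nonneg _) (cellY_norm hq)
      have := wt_pos η
      gcongr
    have h2 := wt_pos η
    have h3 := wt_pos x
    calc _ ≤ (C * (2 ^ (d + 1) * wt x) * wt η) * ((Ma * M) * (Ma * M)) := by
          refine mul_le_mul h1 (mul_le_mul (hvb _ _) (hvb _ _) (norm_nonneg _) (by positivity))
            (by positivity) (by positivity)
      _ = _ := by simp only [D]; ring
  have hBb : ∀ ε, ∀ q, ‖B ε q‖ ≤ G q := by
    intro ε q
    obtain ⟨s, x, η⟩ := q
    simp only [B, P0, G, norm_mul, RCLike.norm_conj]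
    have he : ‖Complex.exp (-Complex.I * ((∑ i, k x i * η i : ℝ) : ℂ))‖ = 1 := by
      have := norm_exp_I (-(∑ i, k x i * η i))
      rw [← this]; congr 2; push_cast; ring
    have h2 := wt_pos η
    have h3 := wt_pos x
    have h4 : ‖((‖a x‖ ^ 2 : ℝ) : ℂ)‖ ≤ Ma ^ 2 := by
      rw [Complex.norm_real, norm_pow, norm_norm]
      have := hMa x
      gcongr
    rw [he, mul_one]
    calc _ ≤ ((C * wt x * wt η) * Ma ^ 2) * (M * M) := by
          refine mul_le_mul (mul_le_mul (hb _ _) h4 (norm_nonneg _) (by positivity))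
            (mul_le_mul (hχM _ _ (hR x)) (hχM _ _ (hR x)) (norm_nonneg _) (by positivity))
            (by positivity) (by positivity)
      _ = 1 * (C * wt x * wt η * Ma ^ 2 * (M * M)) := by ring
      _ ≤ 2 ^ (d + 1) * (C * wt x * wt η * Ma ^ 2 * (M * M)) := by
          gcongr
          exact one_le_pow₀ (by norm_num)
      _ = _ := by simp only [D]; ring
  have hAi : ∀ ε ∈ Set.Ioc (0:ℝ) 1, Integrable (A ε) ν := fun ε hε =>
    hGi.mono' (hAc ε).aestronglyMeasurable (hAb ε hε)
  have hBi : ∀ ε, Integrable (B ε) ν := fun ε =>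
    hGi.mono' (hBc ε).aestronglyMeasurable (Filter.Eventually.of_forall (hBb ε))
  have hev : ∀ᶠ ε in nhdsWithin (0:ℝ) (Set.Ioi 0), ε ∈ Set.Ioc (0:ℝ) 1 :=
    Ioc_mem_nhdsGT one_pos
  -- integral of A
  have hAint : ∀ ε ∈ Set.Ioc (0:ℝ) 1, ∫ q, A ε q ∂ν = ∫ p, J ε p := by
    intro ε hε
    rw [integral_prod _ (hAi ε hε)]
    haveI : (volume : Measure ((Fin d → ℝ) × (Fin d → ℝ))).IsAddRightInvariant :=
      inferInstanceAs (Measure.IsAddRightInvariant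
        ((volume : Measure (Fin d → ℝ)).prod (volume : Measure (Fin d → ℝ))))
    have : ∀ s, ∫ p, A ε (s, p) = ∫ p, J ε p := by
      intro s
      exact integral_add_right_eq_self (fun p => J ε p) ((ε • s, 0) : (Fin d → ℝ) × (Fin d → ℝ))
    simp only [this]
    simp
  -- integral of B
  have hBint : ∀ ε, ∫ q, B ε q ∂ν = ∫ p, P0 p * ∫ y in cellY d, χ (y - (1/2:ℝ) • p.2) (k p.1) *
          starRingEnd ℂ (χ (y + (1/2:ℝ) • p.2) (k p.1)) := by
    intro ε
    rw [integral_prod_symm _ (hBi ε)]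
    congr 1; ext p
    simp only [B]
    rw [integral_const_mul]
    congr 1
    have h1 : Continuous fun y => χ (y - (1/2:ℝ) • p.2) (k p.1) := hχ' _ _ (by fun_prop) (by fun_prop)
    have h2 : Continuous fun y => χ (y + (1/2:ℝ) • p.2) (k p.1) := hχ' _ _ (by fun_prop) (by fun_prop)
    refine cell_shift (fun y => χ (y - (1/2:ℝ) • p.2) (k p.1) *
          starRingEnd ℂ (χ (y + (1/2:ℝ) • p.2) (k p.1))) (h1.mul (Complex.continuous_conj.comp h2)) ?_ _
    intro y γ
    rw [add_right_comm, hχper, add_sub_right_comm, hχper]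
  -- pointwise
  have hpt : ∀ q, Filter.Tendsto (fun ε => A ε q - B ε q) (nhdsWithin (0:ℝ) (Set.Ioi 0)) (nhds 0) := by
    intro q
    obtain ⟨s, x, η⟩ := q
    let um : Fin d → ℝ := s - (1/2:ℝ) • η
    let up : Fin d → ℝ := s + (1/2:ℝ) • η
    have tl : ∀ u : Fin d → ℝ, Filter.Tendsto (fun ε : ℝ => x + ε • u) (nhdsWithin (0:ℝ) (Set.Ioi 0)) (nhds x) := by
      intro u
      have : Continuous (fun ε : ℝ => x + ε • u) := by fun_prop
      have := this.tendsto 0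
      simp only [zero_smul, add_zero] at this
      exact this.mono_left nhdsWithin_le_nhds
    have key := three_lim (l := nhdsWithin (0:ℝ) (Set.Ioi 0))
      (P := fun ε => Φ (x + ε • s, η) * (a (x + ε • um) * starRingEnd ℂ (a (x + ε • up))) *
        Complex.exp (Complex.I * (((φ (x + ε • um) - φ x) / ε - (φ (x + ε • up) - φ x) / ε : ℝ) : ℂ)))
      (X := fun ε => χ (s + ε⁻¹ • x - (1/2:ℝ) • η) (k (x + ε • um)))
      (Y := fun ε => χ (s + ε⁻¹ • x + (1/2:ℝ) • η) (k (x + ε • up)))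
      (X' := fun ε => χ (s + ε⁻¹ • x - (1/2:ℝ) • η) (k x))
      (Y' := fun ε => χ (s + ε⁻¹ • x + (1/2:ℝ) • η) (k x))
      (P0 (x, η)) M hM ?_
      (chi_unif χ hχ hχper _ _ ((hk.tendsto x).comp (tl um)) _)
      (chi_unif χ hχ hχper _ _ ((hk.tendsto x).comp (tl up)) _)
      (fun ε => hχM _ _ (hR _)) (fun ε => hχM _ _ (hR _)) (fun ε => hχM _ _ (hR _))
    · refine key.congr' ?_
      filter_upwards [hev] with ε hε
      have hε0 : ε ≠ 0 := hε.1.ne'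
      simp only [A, J, B, wkbFun, Prod.mk_add_mk, add_zero]
      congr 1
      have e1 : x + ε • s - (ε / 2) • η = x + ε • um := by
        simp only [um, smul_sub, smul_smul]
        rw [add_sub_assoc]; congr 3; ring
      have e2 : x + ε • s + (ε / 2) • η = x + ε • up := by
        simp only [up, smul_add, smul_smul]
        rw [add_assoc]; congr 3; ring
      have e3 : ε⁻¹ • (x + ε • um) = s + ε⁻¹ • x - (1/2:ℝ) • η := by
        rw [smul_add, smul_smul, inv_mul_cancel₀ hε0, one_smul]; simp only [um]; abel
      have e4 : ε⁻¹ • (x + ε • up) = s + ε⁻¹ • x + (1/2:ℝ) • η := by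
        rw [smul_add, smul_smul, inv_mul_cancel₀ hε0, one_smul]; simp only [up]; abel
      rw [e1, e2, e3, e4]
      have e5 : Complex.exp (Complex.I * (((φ (x + ε • um) - φ x) / ε - (φ (x + ε • up) - φ x) / ε : ℝ) : ℂ))
          = Complex.exp (Complex.I * ((φ (x + ε • um) / ε : ℝ) : ℂ)) *
            starRingEnd ℂ (Complex.exp (Complex.I * ((φ (x + ε • up) / ε : ℝ) : ℂ))) := by
        rw [← Complex.exp_conj, ← Complex.exp_add]
        congr 1
        simp only [map_mul, Complex.conj_I, Complex.conj_ofReal]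
        push_cast; ring
      rw [e5]
      simp only [map_mul]
      ring
    · simp only [P0]
      have h1 : Filter.Tendsto (fun ε : ℝ => Φ (x + ε • s, η)) (nhdsWithin (0:ℝ) (Set.Ioi 0)) (nhds (Φ (x, η))) :=
        (hΦ.tendsto (x, η)).comp ((tl s).prodMk_nhds tendsto_const_nhds)
      have h2 := (ha.tendsto x).comp (tl um)
      have h3 := (Complex.continuous_conj.tendsto _).comp ((ha.tendsto x).comp (tl up))
      have h4 := ((phase_lim φ hφ x um).sub (phase_lim φ hφ x up))
      have h50 : Continuous fun r : ℝ => Complex.exp (Complex.I * (r:ℂ)) := by fun_prop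
      have h5 := (h50.tendsto _).comp h4
      have h6 := (h1.mul (h2.mul h3)).mul h5
      convert! h6 using 2
      congr 1
      · congr 1
        rw [Complex.mul_conj, Complex.normSq_eq_norm_sq]
      · congr 1
        rw [← map_sub]
        have : um - up = - η := by
          simp only [um, up]
          ext i; simp; ring
        rw [this, map_neg, spaceGrad_sum]
        push_cast; ring
  have hlim : Filter.Tendsto (fun ε => ∫ q, (A ε q - B ε q) ∂ν) (nhdsWithin (0:ℝ) (Set.Ioi 0)) (nhds 0) := by
    have := tendsto_integral_filter_of_dominated_convergence (μ := ν)
      (l := nhdsWithin (0:ℝ) (Set.Ioi 0)) (F := fun ε q => A ε q - B ε q) (f := fun _ => 0)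
      (fun q => G q + G q)
      (Filter.Eventually.of_forall fun ε => ((hAc ε).sub (hBc ε)).aestronglyMeasurable) ?_
      (hGi.add hGi) (Filter.Eventually.of_forall hpt)
    · simpa using this
    · filter_upwards [hev] with ε hε
      filter_upwards [hAb ε hε] with q hq
      exact (norm_sub_le _ _).trans (add_le_add hq (hBb ε q))
  have hfin := hlim.add_const (∫ p, P0 p * ∫ y in cellY d, χ (y - (1/2:ℝ) • p.2) (k p.1) *
          starRingEnd ℂ (χ (y + (1/2:ℝ) • p.2) (k p.1)))
  rw [zero_add] at hfin
  refine hfin.congr' ?_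
  filter_upwards [hev] with ε hε
  rw [integral_sub (hAi ε hε) (hBi ε), hAint ε hε, hBint ε, sub_add_cancel]

lemma wigner_fubini {d : ℕ} (f : SchwartzMap ((Fin d → ℝ) × (Fin d → ℝ)) ℂ)
    (v : (Fin d → ℝ) → ℂ) (hv : Continuous v) (B : ℝ) (hvb : ∀ x, ‖v x‖ ≤ B)
    (hvi : Integrable v) (ε : ℝ) (hε : 0 < ε) :
    ∫ x : Fin d → ℝ, ∫ ξ : Fin d → ℝ, f (x, ξ) * wignerTransform ε v x ξ =
      ((2 * π) ^ d : ℝ)⁻¹ * ∫ p : (Fin d → ℝ) × (Fin d → ℝ), pF f p *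
        (v (p.1 - (ε / 2) • p.2) * starRingEnd ℂ (v (p.1 + (ε / 2) • p.2))) := by
  have hB : 0 ≤ B := (norm_nonneg _).trans (hvb 0)
  obtain ⟨C, hC, hb⟩ := slice_bound f
  obtain ⟨C', hC', hb'⟩ := pF_bound f
  have hint : Integrable (fun p : (Fin d → ℝ) × (Fin d → ℝ) => pF f p *
        (v (p.1 - (ε / 2) • p.2) * starRingEnd ℂ (v (p.1 + (ε / 2) • p.2)))) (volume.prod volume) := by
    have h1 : Integrable (fun p : (Fin d → ℝ) × (Fin d → ℝ) => (C' * B * B) * (wt p.1 * wt p.2))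
      (volume.prod volume) := ((wt_integrable (d := d)).mul_prod (wt_integrable (d := d))).const_mul _
    refine h1.mono' ?_ (Filter.Eventually.of_forall fun p => ?_)
    · have := pF_continuous f
      have h2 := Complex.continuous_conj
      exact Continuous.aestronglyMeasurable (this.mul ((hv.comp (by fun_prop)).mul
        (h2.comp (hv.comp (by fun_prop)))))
    · rw [norm_mul, norm_mul, RCLike.norm_conj]
      have h3 := hb' p.1 p.2
      have h4 := mul_le_mul (hvb (p.1 - (ε / 2) • p.2)) (hvb (p.1 + (ε / 2) • p.2)) (norm_nonneg _) hB
      have h5 := mul_le_mul h3 h4 (by positivity) ((norm_nonneg _).trans h3)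
      refine h5.trans (le_of_eq (by ring))
  have key : ∀ x : Fin d → ℝ, ∫ ξ : Fin d → ℝ, f (x, ξ) * wignerTransform ε v x ξ =
      ((2 * π) ^ d : ℝ)⁻¹ * ∫ η : Fin d → ℝ, pF f (x, η) *
        (v (x - (ε / 2) • η) * starRingEnd ℂ (v (x + (ε / 2) • η))) := by
    intro x
    have hfx : Integrable (fun ξ : Fin d → ℝ => f (x, ξ)) := by
      refine ((wt_integrable (d := d)).const_mul (C * wt x)).mono' ?_ (Filter.Eventually.of_forall fun ξ => ?_)
      · exact Continuous.aestronglyMeasurable (f.continuous.comp (by fun_prop))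
      · have := hb 0 (by omega) x ξ
        rwa [norm_iteratedFDeriv_zero] at this
    have hvx : Integrable (fun η : Fin d → ℝ => v (x - (ε / 2) • η) * starRingEnd ℂ (v (x + (ε / 2) • η))) := by
      have h1 : Integrable (fun η : Fin d → ℝ => v (x - (ε / 2) • η)) := by
        have := (hvi.comp_sub_left x).comp_smul (R := ε / 2) (by positivity)
        exact this
      refine (h1.norm.mul_const B).mono' ?_ (Filter.Eventually.of_forall fun η => ?_)
      · exact Continuous.aestronglyMeasurable ((hv.comp (by fun_prop)).mul
          (Complex.continuous_conj.comp (hv.comp (by fun_prop))))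
      · rw [norm_mul, RCLike.norm_conj]
        exact mul_le_mul_of_nonneg_left (hvb _) (norm_nonneg _)
    have hprod : Integrable (Function.uncurry fun (ξ η : Fin d → ℝ) =>
        f (x, ξ) * (v (x - (ε / 2) • η) * starRingEnd ℂ (v (x + (ε / 2) • η)) *
        Complex.exp (Complex.I * ((∑ i, ξ i * η i : ℝ) : ℂ)))) (volume.prod volume) := by
      refine (hfx.mul_prod hvx).norm.mono' ?_ (Filter.Eventually.of_forall fun p => ?_)
      · refine Continuous.aestronglyMeasurable ?_
        exact (f.continuous.comp (by fun_prop)).mul (((hv.comp (by fun_prop)).mul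
          (Complex.continuous_conj.comp (hv.comp (by fun_prop)))).mul (by fun_prop))
      · simp only [Function.uncurry]
        rw [norm_mul, norm_mul, norm_exp_I, mul_one, norm_mul (f (x, p.1))]
    calc ∫ ξ : Fin d → ℝ, f (x, ξ) * wignerTransform ε v x ξ
        = ∫ ξ : Fin d → ℝ, ((2 * π) ^ d : ℝ)⁻¹ * ∫ η : Fin d → ℝ,
            f (x, ξ) * (v (x - (ε / 2) • η) * starRingEnd ℂ (v (x + (ε / 2) • η)) *
        Complex.exp (Complex.I * ((∑ i, ξ i * η i : ℝ) : ℂ))) := by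
          congr 1; ext ξ
          rw [integral_const_mul, wignerTransform]; ring
      _ = ((2 * π) ^ d : ℝ)⁻¹ * ∫ η : Fin d → ℝ, ∫ ξ : Fin d → ℝ, 
            f (x, ξ) * (v (x - (ε / 2) • η) * starRingEnd ℂ (v (x + (ε / 2) • η)) *
        Complex.exp (Complex.I * ((∑ i, ξ i * η i : ℝ) : ℂ))) := by
          rw [integral_const_mul, integral_integral_swap hprod]
      _ = _ := by
          congr 2; ext η
          rw [pF, ← integral_mul_const]
          congr 1; ext ξ
          ring
  simp_rw [key]
  rw [integral_const_mul, Measure.volume_eq_prod, integral_prod _ hint]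

lemma limit_ident {d : ℕ} (f : SchwartzMap ((Fin d → ℝ) × (Fin d → ℝ)) ℂ)
    (a : (Fin d → ℝ) → ℂ) (ha : Continuous a) (Ma : ℝ) (hMa : ∀ x, ‖a x‖ ≤ Ma)
    (k : (Fin d → ℝ) → (Fin d → ℝ)) (hk : Continuous k)
    (R : ℝ) (hR : ∀ x, ‖k x‖ ≤ R)
    (χ : (Fin d → ℝ) → (Fin d → ℝ) → ℂ)
    (hχ : Continuous (fun p : (Fin d → ℝ) × (Fin d → ℝ) => χ p.1 p.2))
    (hχper : ∀ (y k : Fin d → ℝ) (γ : Fin d → ℤ), χ (y + fun i => (γ i : ℝ)) k = χ y k) :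
    HasSum (fun m : Fin d → ℤ => ∫ x : Fin d → ℝ,
        f (x, k x + fun i => 2 * π * (m i : ℝ)) *
          ((‖a x‖ ^ 2 : ℝ) : ℂ) *
          ((‖blochFourierCoeff χ m (k x)‖ ^ 2 : ℝ) : ℂ))
      (((2 * π) ^ d : ℝ)⁻¹ * (∫ p : (Fin d → ℝ) × (Fin d → ℝ), pF f p * ((‖a p.1‖ ^ 2 : ℝ) : ℂ) *
        Complex.exp (-Complex.I * ((∑ i, k p.1 i * p.2 i : ℝ) : ℂ)) *
        ∫ y in cellY d, χ (y - (1/2:ℝ) • p.2) (k p.1) *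
          starRingEnd ℂ (χ (y + (1/2:ℝ) • p.2) (k p.1)))) := by
  have hMa0 : 0 ≤ Ma := (norm_nonneg _).trans (hMa 0)
  obtain ⟨M, hM, hχM⟩ := chi_bdd χ hχ hχper R
  obtain ⟨C, hC, hb⟩ := pF_bound f
  have hpc := pF_continuous f
  have hχc : ∀ k, Continuous fun y => χ y k := fun k => hχ.comp (continuous_id.prodMk continuous_const)
  have hcc : ∀ m, Continuous fun x => blochFourierCoeff χ m (k x) := by
    intro m
    unfold blochFourierCoeff
    refine continuous_parametric_integral_of_continuous ?_ (cellY_compact d)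
    have h1 : Continuous fun q : (Fin d → ℝ) × (Fin d → ℝ) => χ q.2 (k q.1) :=
      hχ.comp (continuous_snd.prodMk (hk.comp continuous_fst))
    exact h1.mul (by fun_prop)
  have hauto := fun (x η : Fin d → ℝ) => cell_autocorr (fun y => χ y (k x)) (hχc _) (fun y γ => hχper y _ γ) η
  -- Parseval at zero
  have hpars : ∀ x, ∃ S : ℝ, HasSum (fun m => ‖blochFourierCoeff χ m (k x)‖ ^ 2) S ∧ S ≤ M * M := by
    intro x
    have h0 := hauto x 0
    simp only [Pi.zero_apply, zero_mul, Finset.sum_const_zero, Complex.ofReal_zero, mul_zero,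
      Complex.exp_zero, mul_one, smul_zero, sub_zero, add_zero] at h0
    have h1 := h0.mapL Complex.reCLM
    refine ⟨_, h1, ?_⟩
    refine (Complex.re_le_norm _).trans ?_
    have h2 := norm_setIntegral_le_of_norm_le_const (μ := volume) (s := cellY d) (C := M * M)
      (f := fun y => χ y (k x) * starRingEnd ℂ (χ y (k x))) (by rw [cellY_vol]; simp) (fun y _ => by
        rw [norm_mul, RCLike.norm_conj]
        exact mul_le_mul (hχM _ _ (hR x)) (hχM _ _ (hR x)) (norm_nonneg _) hM)
    simpa [Measure.real, cellY_vol] using h2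
  have hgi : Integrable (fun p : (Fin d → ℝ) × (Fin d → ℝ) => (C * (Ma ^ 2) * (M * M)) * (wt p.1 * wt p.2))
      (volume.prod volume) := ((wt_integrable (d := d)).mul_prod (wt_integrable (d := d))).const_mul _
  let F : (Fin d → ℤ) → (Fin d → ℝ) × (Fin d → ℝ) → ℂ := fun m p =>
    pF f p * ((‖a p.1‖ ^ 2 : ℝ) : ℂ) *
        Complex.exp (-Complex.I * ((∑ i, k p.1 i * p.2 i : ℝ) : ℂ)) *
        (((‖blochFourierCoeff χ m (k p.1)‖^2:ℝ):ℂ) *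
          Complex.exp (-Complex.I * ((∑ i, p.2 i*(2*π*(m i:ℝ)) :ℝ):ℂ)))
  have hne : ∀ r : ℝ, ‖Complex.exp (-Complex.I * (r : ℂ))‖ = 1 := by
    intro r
    have := norm_exp_I (-r)
    rwa [Complex.ofReal_neg, mul_neg, ← neg_mul] at this
  have hFc : ∀ m, Continuous (F m) := by
    intro m
    have h1 : Continuous fun p : (Fin d → ℝ) × (Fin d → ℝ) => blochFourierCoeff χ m (k p.1) :=
      (hcc m).comp continuous_fst
    simp only [F]
    fun_prop
  have hFn : ∀ m p, ‖F m p‖ = ‖pF f p‖ * ‖a p.1‖ ^ 2 * ‖blochFourierCoeff χ m (k p.1)‖^2 := by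
    intro m p
    simp only [F]
    rw [norm_mul, norm_mul, norm_mul, norm_mul, hne, hne, Complex.norm_real, Complex.norm_real]
    simp
  have hF1 : ∀ p : (Fin d → ℝ) × (Fin d → ℝ), ‖pF f p‖ * ‖a p.1‖ ^ 2 ≤ C * Ma ^ 2 * (wt p.1 * wt p.2) := by
    intro p
    have h1 := hb p.1 p.2
    have h2 := pow_le_pow_left₀ (norm_nonneg _) (hMa p.1) 2
    have := mul_le_mul h1 h2 (by positivity) ((norm_nonneg _).trans h1)
    exact this.trans (le_of_eq (by ring))
  have hS : HasSum (fun m => ∫ p, F m p ∂(volume.prod volume)) (∫ p : (Fin d → ℝ) × (Fin d → ℝ), pF f p * ((‖a p.1‖ ^ 2 : ℝ) : ℂ) *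
        Complex.exp (-Complex.I * ((∑ i, k p.1 i * p.2 i : ℝ) : ℂ)) *
        (∫ y in cellY d, χ (y - (1/2:ℝ) • p.2) (k p.1) *
          starRingEnd ℂ (χ (y + (1/2:ℝ) • p.2) (k p.1))) ∂(volume.prod volume)) := by
    refine hasSum_integral_of_dominated_convergence (fun m p => ‖F m p‖)
      (fun m => (hFc m).aestronglyMeasurable) (fun m => Filter.Eventually.of_forall fun p => le_rfl)
      (Filter.Eventually.of_forall fun p => ?_) ?_ (Filter.Eventually.of_forall fun p => ?_)
    · simp_rw [hFn]
      obtain ⟨S, h, _⟩ := hpars p.1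
      exact h.summable.mul_left _
    · refine hgi.mono' ?_ (Filter.Eventually.of_forall fun p => ?_)
      · exact (Measurable.tsum fun m => (hFc m).norm.measurable).aestronglyMeasurable
      · obtain ⟨S, h, hS⟩ := hpars p.1
        simp_rw [hFn]
        rw [tsum_mul_left, h.tsum_eq]
        have hS0 : 0 ≤ S := h.nonneg fun m => by positivity
        rw [Real.norm_of_nonneg (by positivity)]
        have := mul_le_mul (hF1 p) hS hS0 (by have := wt_pos p.1; have := wt_pos p.2; positivity)
        exact this.trans (le_of_eq (by ring))
    · exact (hauto p.1 p.2).mul_left _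
  have hFi : ∀ m, Integrable (F m) (volume.prod volume) := by
    intro m
    refine hgi.mono' (hFc m).aestronglyMeasurable (Filter.Eventually.of_forall fun p => ?_)
    obtain ⟨S, h, hS⟩ := hpars p.1
    rw [hFn]
    have h2 := (le_hasSum h m fun j _ => by positivity).trans hS
    have := mul_le_mul (hF1 p) h2 (by positivity) (by have := wt_pos p.1; have := wt_pos p.2; positivity)
    exact this.trans (le_of_eq (by ring))
  have hS2 := hS.mul_left ((((2 * π) ^ d : ℝ)⁻¹ : ℝ) : ℂ)
  rw [Measure.volume_eq_prod]
  push_cast at hS2 ⊢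
  convert! hS2 using 1
  ext m
  rw [integral_prod _ (hFi m), ← integral_const_mul]
  congr 1; ext x
  have hinv := pF_inversion f x (k x + fun i => 2 * π * (m i : ℝ))
  rw [← hinv]
  push_cast
  rw [mul_assoc, mul_assoc, ← integral_mul_const]
  congr 1
  congr 1; ext η
  simp only [F]
  have he : Complex.exp (-Complex.I * ∑ i, ((k x + fun i => 2 * π * (m i : ℝ)) i : ℂ) * (η i : ℂ)) =
    Complex.exp (-Complex.I * ((∑ i, k x i * η i : ℝ) : ℂ)) *
     Complex.exp (-Complex.I * ((∑ i, η i*(2*π*(m i:ℝ)) :ℝ):ℂ)) := by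
    rw [← Complex.exp_add, ← mul_add, ← Complex.ofReal_add, ← Finset.sum_add_distrib]
    congr 2
    push_cast
    refine Finset.sum_congr rfl fun i _ => ?_
    simp
    ring
  rw [he]
  push_cast
  ring
theorem wigner_measure_of_two_scale_wkb
    (d : ℕ) (hd : 1 ≤ d)
    (a : SchwartzMap (Fin d → ℝ) ℂ)
    (φ : (Fin d → ℝ) → ℝ) (hφ : ContDiff ℝ (⊤ : ℕ∞) φ)
    (hφbd : ∀ n : ℕ, 1 ≤ n → ∃ C : ℝ, ∀ x, ‖iteratedFDeriv ℝ n φ x‖ ≤ C)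
    (χ : (Fin d → ℝ) → (Fin d → ℝ) → ℂ)
    (hχ : ContDiff ℝ (⊤ : ℕ∞) (fun p : (Fin d → ℝ) × (Fin d → ℝ) => χ p.1 p.2))
    (hχper : ∀ (y k : Fin d → ℝ) (γ : Fin d → ℤ),
      χ (y + fun i => (γ i : ℝ)) k = χ y k)
    (f : SchwartzMap ((Fin d → ℝ) × (Fin d → ℝ)) ℂ) :
    Filter.Tendsto
      (fun ε : ℝ => ∫ x : Fin d → ℝ, ∫ ξ : Fin d → ℝ,
        f (x, ξ) * wignerTransform ε (wkbFun (fun y => a y) φ χ ε) x ξ)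
      (nhdsWithin 0 (Set.Ioi 0))
      (nhds (∑' m : Fin d → ℤ, ∫ x : Fin d → ℝ,
        f (x, spaceGrad φ x + fun i => 2 * π * (m i : ℝ)) *
          ((‖a x‖ ^ 2 : ℝ) : ℂ) *
          ((‖blochFourierCoeff χ m (spaceGrad φ x)‖ ^ 2 : ℝ) : ℂ))) := by
  have hχc := hχ.continuous
  have hφd : Differentiable ℝ φ := hφ.differentiable (by simp)
  have hk : Continuous (spaceGrad φ) := by
    refine continuous_pi fun i => ?_
    exact (hφ.continuous_fderiv (by simp)).clm_apply continuous_const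
  obtain ⟨R, hR⟩ := hφbd 1 le_rfl
  have hR' : ∀ x, ‖spaceGrad φ x‖ ≤ R := by
    intro x
    have h1 := hR x
    rw [norm_iteratedFDeriv_one] at h1
    refine (pi_norm_le_iff_of_nonneg ((norm_nonneg _).trans h1)).2 fun i => ?_
    refine ((fderiv ℝ φ x).le_opNorm _).trans ?_
    have h2 : ‖(Pi.single i 1 : Fin d → ℝ)‖ = 1 := by rw [Pi.norm_single]; simp
    rwa [h2, mul_one]
  obtain ⟨Ma, hMa⟩ : ∃ Ma, ∀ x, ‖a x‖ ≤ Ma := ⟨_, fun x => SchwartzMap.norm_le_seminorm ℝ a x⟩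
  obtain ⟨C, hC, hb⟩ := pF_bound f
  obtain ⟨M, hM, hχM⟩ := chi_bdd χ hχc hχper R
  have hlim := core_limit (pF f) (pF_continuous f) C hC hb (fun y => a y) a.continuous Ma hMa φ hφd hk
    R hR' χ hχc hχper
  have hS := limit_ident f (fun y => a y) a.continuous Ma hMa (spaceGrad φ) hk R hR' χ hχc hχper
  rw [hS.tsum_eq]
  refine (hlim.const_mul ((((2 * π) ^ d : ℝ)⁻¹ : ℝ) : ℂ)).congr' ?_
  filter_upwards [self_mem_nhdsWithin] with ε hε
  have hvc : Continuous (wkbFun (fun y => a y) φ χ ε) := by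
    unfold wkbFun
    have h1 : Continuous fun x : Fin d → ℝ => χ (ε⁻¹ • x) (spaceGrad φ x) := 
      hχc.comp ((continuous_const_smul ε⁻¹).prodMk hk)
    have := hφd.continuous
    exact (a.continuous.mul h1).mul (by fun_prop)
  have hvn : ∀ x, ‖wkbFun (fun y => a y) φ χ ε x‖ ≤ ‖a x‖ * M := by
    intro x
    unfold wkbFun
    rw [norm_mul, norm_exp_I, mul_one, norm_mul]
    exact mul_le_mul_of_nonneg_left (hχM _ _ (hR' x)) (norm_nonneg _)
  exact (wigner_fubini f _ hvc (Ma * M)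
    (fun x => (hvn x).trans (mul_le_mul_of_nonneg_right (hMa x) hM))
    ((a.integrable.norm.mul_const M).mono' hvc.aestronglyMeasurable
      (Filter.Eventually.of_forall hvn)) ε hε).symm
end
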